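/- Suppose the normalized two-sided integral Λ of H is cocommutative. Then for every m ≥ 1, Δ^m(Λ) is invariant under cyclic permutations: Σ_(Λ) Λ₁ ⊗ Λ₂ ⊗ ⋯ ⊗ Λ_{m+1} = Σ_(Λ) Λ₂ ⊗ ⋯ ⊗ Λ_{m+1} ⊗ Λ₁. -/

import Mathlib

open TensorProduct

noncomputable section

universe u

variable (k : Type u) [Field k]

/-- `twistedMulMap τ n : h ↦ Σ h₁ · τ(h₂) · ⋯ · τⁿ(h_{n+1})`, the product of the `n+1`
Sweedler factors of the iterated comultiplication with the twist `τ` applied progressively. -/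
def twistedMulMap (H : Type u) [Ring H] [HopfAlgebra k H] (τ : H →ₗ[k] H) :
    ℕ → (H →ₗ[k] H)
  | 0 => LinearMap.id
  | n + 1 => LinearMap.mul' k H ∘ₗ TensorProduct.map LinearMap.id (τ ∘ₗ twistedMulMap H τ n)
      ∘ₗ Coalgebra.comul (R := k)

/-- `powLM τ n` is the `n`-fold composition `τ ∘ ⋯ ∘ τ`. -/
def powLM (H : Type u) [Ring H] [HopfAlgebra k H] (τ : H →ₗ[k] H) : ℕ → (H →ₗ[k] H)
  | 0 => LinearMap.id
  | n + 1 => τ ∘ₗ powLM H τ n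

/-- Bundled `n`-fold tensor power `V ⊗ (V ⊗ (⋯ ⊗ k))`. -/
def TPc (V : Type u) [AddCommGroup V] [Module k V] : ℕ → ModuleCat.{u} k
  | 0 => ModuleCat.of k k
  | n + 1 => ModuleCat.of k (V ⊗[k] (TPc V n : Type u))

/-- The `n`-fold tensor power `V^{⊗n}` of `V` (with a trailing scalar factor). -/
abbrev TP (V : Type u) [AddCommGroup V] [Module k V] (n : ℕ) : Type u := (TPc k V n : Type u)

variable (H : Type u) [Ring H] [HopfAlgebra k H]
variable (V : Type u) [AddCommGroup V] [Module k V]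

/-- Append a vector at the end of a tensor power. -/
def TP.snoc : ∀ n, (TP k V n ⊗[k] V) →ₗ[k] TP k V (n + 1)
  | 0 => (TensorProduct.comm k k V).toLinearMap
  | n + 1 => (TensorProduct.map LinearMap.id (TP.snoc n)) ∘ₗ
      (TensorProduct.assoc k V (TP k V n) V).toLinearMap

/-- The cyclic shift `α : v₁ ⊗ v₂ ⊗ ⋯ ⊗ vₙ ↦ v₂ ⊗ ⋯ ⊗ vₙ ⊗ v₁`. -/
def TP.cyc : ∀ n, TP k V n →ₗ[k] TP k V n
  | 0 => LinearMap.id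
  | n + 1 => TP.snoc k V n ∘ₗ (TensorProduct.comm k V (TP k V n)).toLinearMap

/-- Iterated comultiplication `Δ^{n-1} : h ↦ Σ h₁ ⊗ h₂ ⊗ ⋯ ⊗ hₙ` (`n` Sweedler factors). -/
def TP.iterComul : ∀ n, H →ₗ[k] TP k H n
  | 0 => Coalgebra.counit (R := k)
  | n + 1 => TensorProduct.map LinearMap.id (TP.iterComul n) ∘ₗ Coalgebra.comul (R := k)

/-- Coassociativity, after applying `f` to the second tensor factor and then `s` to the last two. -/
theorem map_assoc_map_comul_comul {C M N : Type*} [AddCommGroup C] [Module k C] [Coalgebra k C]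
    [AddCommGroup M] [Module k M] [AddCommGroup N] [Module k N]
    (f : C →ₗ[k] M) (s : M ⊗[k] C →ₗ[k] N) (c : C) :
    TensorProduct.map LinearMap.id s (TensorProduct.assoc k C M C
      (TensorProduct.map (TensorProduct.map LinearMap.id f ∘ₗ Coalgebra.comul (R := k))
        LinearMap.id (Coalgebra.comul (R := k) c))) =
    TensorProduct.map LinearMap.id
      (s ∘ₗ TensorProduct.map f LinearMap.id ∘ₗ Coalgebra.comul (R := k))
      (Coalgebra.comul (R := k) c) := by
  have map_comul : TensorProduct.map (TensorProduct.map LinearMap.id f ∘ₗ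
          Coalgebra.comul (R := k)) LinearMap.id (Coalgebra.comul (R := k) c) =
      TensorProduct.map (TensorProduct.map LinearMap.id f) LinearMap.id
        ((Coalgebra.comul (R := k)).rTensor C (Coalgebra.comul (R := k) c)) := by
    rw [LinearMap.rTensor, TensorProduct.map_map, LinearMap.id_comp]
  rw [map_comul, ← TensorProduct.map_map_assoc, Coalgebra.coassoc_apply, LinearMap.lTensor,
    TensorProduct.map_map, TensorProduct.map_map]
  simp only [LinearMap.id_comp, LinearMap.comp_assoc]

/-- Splitting the last Sweedler factor off an iterated comultiplication:
`Δ^n(h) = Σ Δ^{n-1}(h₁) ⊗ h₂`. -/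
theorem TP.snoc_map_iterComul_comul (n : ℕ) (h : H) :
    TP.snoc k H n (TensorProduct.map (TP.iterComul k H n) LinearMap.id
      (Coalgebra.comul (R := k) h)) = TP.iterComul k H (n + 1) h := by
  induction n generalizing h with
  | zero =>
    change TensorProduct.comm k k H ((Coalgebra.counit (R := k)).rTensor H
        (Coalgebra.comul (R := k) h)) =
      (Coalgebra.counit (R := k)).lTensor H (Coalgebra.comul (R := k) h)
    rw [Coalgebra.rTensor_counit_comul, Coalgebra.lTensor_counit_comul]
    rfl
  | succ n ih =>
    refine (map_assoc_map_comul_comul k (TP.iterComul k H n) (TP.snoc k H n) h).trans ?_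
    rw [show TP.snoc k H n ∘ₗ TensorProduct.map (TP.iterComul k H n) LinearMap.id ∘ₗ
      Coalgebra.comul (R := k) = TP.iterComul k H (n + 1) from LinearMap.ext ih]
    rfl

/-- **Theorem.** Let `H` be a finite-dimensional Hopf algebra over a field of characteristic `0`
whose normalized two-sided integral `Λ` is cocommutative.  Then for every `m ≥ 1` the iterated
comultiplication `Δ^m(Λ) = Σ Λ₁ ⊗ ⋯ ⊗ Λ_{m+1}` is invariant under cyclic permutation:
`Σ Λ₁ ⊗ Λ₂ ⊗ ⋯ ⊗ Λ_{m+1} = Σ Λ₂ ⊗ ⋯ ⊗ Λ_{m+1} ⊗ Λ₁`. -/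
theorem iterated_comul_of_cocommutative_integral_is_cyclic_invariant
    [CharZero k] [FiniteDimensional k H]
    (Λ : H)
    (hΛleft : ∀ a : H, a * Λ = Coalgebra.counit (R := k) a • Λ)
    (hΛright : ∀ a : H, Λ * a = Coalgebra.counit (R := k) a • Λ)
    (hΛone : Coalgebra.counit (R := k) Λ = 1)
    (hΛcc : TensorProduct.comm k H H (Coalgebra.comul (R := k) Λ) = Coalgebra.comul (R := k) Λ) :
    ∀ m : ℕ, 1 ≤ m →
      TP.cyc k H (m + 1) (TP.iterComul k H (m + 1) Λ) = TP.iterComul k H (m + 1) Λ := by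
  intro m _
  change TP.snoc k H m (TensorProduct.comm k H (TP k H m)
    (TensorProduct.map LinearMap.id (TP.iterComul k H m) (Coalgebra.comul (R := k) Λ))) = _
  rw [← TensorProduct.map_comm, hΛcc]
  exact TP.snoc_map_iterComul_comul k H m Λ

end
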